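/- arXiv:1310.0812 — 6 statements merged into one kernel-verified Lean document; each statement's English description precedes it below -/
import Mathlib

section
/- Let λ ∈ ℝ, let l ≥ 0 be an integer, and let p be a real polynomial of degree exactly l (leading coefficient nonzero). If the function z ↦ p(z) satisfies the pencil equation with parameter λ, then λ² + (2l+1)λ + l(l+1) = 0; equivalently, λ = −l or λ = −(l+1). -/
open Polynomial

/-- The coefficients of the pencil operator applied to a polynomial. -/
theorem coeff_pencil {R : Type*} [CommRing R] (lam : R) (p : R[X]) (n : ℕ) :
    ((1 + X ^ 2) * derivative (derivative p) + C (2 * (lam + 1)) * (X * derivative p)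
      + C (lam * (lam + 1)) * p).coeff n
      = (n + 1) * (n + 2) * p.coeff (n + 2) + (lam + n) * (lam + n + 1) * p.coeff n := by
  rcases n with _ | _ | n <;>
    simp [add_mul, pow_two, mul_assoc, coeff_X_mul, coeff_derivative, coeff_C_mul] <;> ring_nf

/-- If a real polynomial of degree exactly `l` satisfies the pencil equation
with parameter `lam`, then `lam² + (2l+1)lam + l(l+1) = 0`, i.e. `lam = −l` or `lam = −(l+1)`. -/
theorem pencil_polynomial_eigenvalue (lam : ℝ) (l : ℕ) (p : Polynomial ℝ)
    (hdeg : p.natDegree = l) (hlead : p.coeff l ≠ 0)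
    (hpencil : ∀ z : ℝ, (1 + z ^ 2) * (Polynomial.derivative (Polynomial.derivative p)).eval z
        + 2 * (lam + 1) * z * (Polynomial.derivative p).eval z
        + lam * (lam + 1) * p.eval z = 0) :
    lam ^ 2 + (2 * (l : ℝ) + 1) * lam + (l : ℝ) * ((l : ℝ) + 1) = 0
      ∧ (lam = -(l : ℝ) ∨ lam = -((l : ℝ) + 1)) := by
  have hpoly : (1 + X ^ 2) * derivative (derivative p) + C (2 * (lam + 1)) * (X * derivative p)
      + C (lam * (lam + 1)) * p = 0 := by
    refine Polynomial.funext fun z => ?_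
    simpa [mul_assoc] using hpencil z
  have hcoeff := coeff_pencil lam p l
  rw [hpoly, coeff_zero, coeff_eq_zero_of_natDegree_lt (n := l + 2) (by lia), mul_zero,
    zero_add] at hcoeff
  have hroots : (lam + l) * (lam + l + 1) = 0 :=
    (mul_eq_zero.mp hcoeff.symm).resolve_right hlead
  refine ⟨by linear_combination hroots, (mul_eq_zero.mp hroots).imp ?_ ?_⟩ <;>
    intro h <;> linear_combination h
end

section
/- For every integer l ≥ 1 and for λ = −l, the pencil equation with parameter λ admits two linearly independent polynomial solutions: a monic real polynomial p of degree exactly l with (1+z²)p''(z) + 2(1−l)z p'(z) + l(l−1)p(z) = 0 for all z ∈ ℝ, and a monic real polynomial q of degree exactly l−1 satisfying the same equation. -/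
open Polynomial in
/-- The real and imaginary parts of the polynomial `(X + i) ^ n`. -/
noncomputable def rePowImPow : ℕ → ℝ[X] × ℝ[X]
  | 0 => (1, 0)
  | n + 1 => (X * (rePowImPow n).1 - (rePowImPow n).2, (rePowImPow n).1 + X * (rePowImPow n).2)

namespace rePowImPow

open Polynomial

lemma derivative_succ (n : ℕ) :
    derivative (rePowImPow (n + 1)).1 = C ((n : ℝ) + 1) * (rePowImPow n).1 ∧
      derivative (rePowImPow (n + 1)).2 = C ((n : ℝ) + 1) * (rePowImPow n).2 := by
  induction n with
  | zero => simp [rePowImPow]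
  | succ n ih =>
    obtain ⟨hp, hq⟩ := ih
    rw [rePowImPow]
    simp only [derivative_sub, derivative_add, derivative_mul, derivative_X, hp, hq]
    rw [rePowImPow]
    simp only [Nat.cast_add, Nat.cast_one, C_add, C_1]
    constructor <;> ring

lemma natDegree_le_and_coeff (n : ℕ) :
    ((rePowImPow n).1.natDegree ≤ n ∧ (rePowImPow n).1.coeff n = 1) ∧
      (rePowImPow (n + 1)).2.natDegree ≤ n ∧ (rePowImPow (n + 1)).2.coeff n = n + 1 := by
  induction n with
  | zero => simp [rePowImPow]
  | succ n ih =>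
    obtain ⟨⟨hp, hpc⟩, hq, hqc⟩ := ih
    have hXmul {r : ℝ[X]} (hr : r.natDegree ≤ n) : (X * r).natDegree ≤ n + 1 := by
      simpa [add_comm] using natDegree_mul_le_of_le natDegree_X_le hr
    have hq₀ : (rePowImPow n).2.natDegree ≤ n ∧ (rePowImPow n).2.coeff (n + 1) = 0 := by
      suffices h : (rePowImPow n).2.natDegree ≤ n from
        ⟨h, coeff_eq_zero_of_natDegree_lt (by omega)⟩
      have h : X * (rePowImPow n).2 = (rePowImPow (n + 1)).2 - (rePowImPow n).1 := by
        simp [rePowImPow]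
      by_cases h0 : (rePowImPow n).2 = 0
      · simp [h0]
      · have := natDegree_sub_le_of_le hq hp
        rw [← h, natDegree_X_mul h0] at this
        simp at this
        omega
    have hp' : (rePowImPow (n + 1)).1.natDegree ≤ n + 1 := by
      rw [rePowImPow]
      exact (natDegree_sub_le_of_le (hXmul hp) (hq₀.1.trans n.le_succ)).trans (by simp)
    have hpc' : (rePowImPow (n + 1)).1.coeff (n + 1) = 1 := by
      simp [rePowImPow, coeff_X_mul, hpc, hq₀.2]
    refine ⟨⟨hp', hpc'⟩, ?_, ?_⟩
    · rw [rePowImPow]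
      exact natDegree_add_le_of_degree_le hp' (hXmul hq)
    · rw [rePowImPow]
      simp only [coeff_add, coeff_X_mul, hpc', hqc]
      push_cast
      ring

lemma pencil_eq (n : ℕ) (z : ℝ) :
    ((1 + z ^ 2) * (derivative (derivative (rePowImPow n).1)).eval z
        + 2 * (1 - (n : ℝ)) * z * (derivative (rePowImPow n).1).eval z
        + (n : ℝ) * ((n : ℝ) - 1) * (rePowImPow n).1.eval z = 0) ∧
      (1 + z ^ 2) * (derivative (derivative (rePowImPow n).2)).eval z
        + 2 * (1 - (n : ℝ)) * z * (derivative (rePowImPow n).2).eval z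
        + (n : ℝ) * ((n : ℝ) - 1) * (rePowImPow n).2.eval z = 0 := by
  match n with
  | 0 => simp [rePowImPow]
  | 1 => simp [rePowImPow]
  | n + 2 =>
    obtain ⟨hp, hq⟩ := derivative_succ n
    obtain ⟨hp', hq'⟩ := derivative_succ (n + 1)
    simp only [hp', hq', derivative_C_mul, hp, hq]
    simp only [rePowImPow, eval_mul, eval_add, eval_sub, eval_C, eval_X]
    push_cast
    constructor <;> ring

end rePowImPow

/-- For every integer `l ≥ 1` and `lam = −l`, the pencil equation admits two
linearly independent polynomial solutions: a monic polynomial of degree exactly `l` and a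
monic polynomial of degree exactly `l − 1`, both satisfying
`(1+z²)p''(z) + 2(1−l)z p'(z) + l(l−1)p(z) = 0` for all `z`. -/
theorem pencil_two_polynomial_eigenfunctions (l : ℕ) (hl : 1 ≤ l) :
    ∃ p q : Polynomial ℝ,
      p.Monic ∧ p.natDegree = l ∧
      q.Monic ∧ q.natDegree = l - 1 ∧
      (∀ z : ℝ, (1 + z ^ 2) * (Polynomial.derivative (Polynomial.derivative p)).eval z
          + 2 * (1 - (l : ℝ)) * z * (Polynomial.derivative p).eval z
          + (l : ℝ) * ((l : ℝ) - 1) * p.eval z = 0) ∧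
      (∀ z : ℝ, (1 + z ^ 2) * (Polynomial.derivative (Polynomial.derivative q)).eval z
          + 2 * (1 - (l : ℝ)) * z * (Polynomial.derivative q).eval z
          + (l : ℝ) * ((l : ℝ) - 1) * q.eval z = 0) := by
  obtain ⟨n, rfl⟩ : ∃ n, l = n + 1 := ⟨l - 1, by omega⟩
  obtain ⟨hp, hpc⟩ := (rePowImPow.natDegree_le_and_coeff (n + 1)).1
  obtain ⟨hq, hqc⟩ := (rePowImPow.natDegree_le_and_coeff n).2
  have hn : (n : ℝ) + 1 ≠ 0 := by positivity
  have hq' := (Polynomial.natDegree_C_mul_le ((n : ℝ) + 1)⁻¹ (rePowImPow (n + 1)).2).trans hq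
  have hqc' : (Polynomial.C ((n : ℝ) + 1)⁻¹ * (rePowImPow (n + 1)).2).coeff n = 1 := by
    rw [Polynomial.coeff_C_mul, hqc, inv_mul_cancel₀ hn]
  refine ⟨(rePowImPow (n + 1)).1, Polynomial.C ((n : ℝ) + 1)⁻¹ * (rePowImPow (n + 1)).2,
    Polynomial.monic_of_natDegree_le_of_coeff_eq_one _ hp hpc,
    Polynomial.natDegree_eq_of_le_of_coeff_ne_zero hp (by simp [hpc]),
    Polynomial.monic_of_natDegree_le_of_coeff_eq_one _ hq' hqc',
    Polynomial.natDegree_eq_of_le_of_coeff_ne_zero hq' (by simp [hqc']),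
    fun z => (rePowImPow.pencil_eq (n + 1) z).1, fun z => ?_⟩
  have h := (rePowImPow.pencil_eq (n + 1) z).2
  simp only [Polynomial.derivative_C_mul, Polynomial.eval_mul, Polynomial.eval_C]
  linear_combination ((n : ℝ) + 1)⁻¹ * h
end

section
/- Let w : ℝ × ℝ → ℝ be twice continuously differentiable, and for (x,y) ∈ ℝ × (−∞,0) define u(x,y) = w(x/(−y), −ln(−y)). Then u is twice differentiable on the lower half-plane {y < 0} and for every x ∈ ℝ and y < 0, writing z = x/(−y) and τ = −ln(−y), the Laplacian satisfies ∂²u/∂x²(x,y) + ∂²u/∂y²(x,y) = y^{−2}·[w_ττ(z,τ) + w_τ(z,τ) + 2z·w_zτ(z,τ) + (1+z²)·w_zz(z,τ) + 2z·w_z(z,τ)], where subscripts denote partial derivatives of w with respect to its first variable z and second variable τ. -/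
/-- Chain rule along a planar curve, expressed with the partial derivatives of `F`. -/
theorem hasDerivAt_comp_curve {F : ℝ × ℝ → ℝ} (hF : Differentiable ℝ F) {a b : ℝ → ℝ}
    {a' b' t : ℝ} (ha : HasDerivAt a a' t) (hb : HasDerivAt b b' t) :
    HasDerivAt (fun s => F (a s, b s))
      (a' * fderiv ℝ F (a t, b t) (1, 0) + b' * fderiv ℝ F (a t, b t) (0, 1)) t := by
  have h := (hF (a t, b t)).hasFDerivAt.comp_hasDerivAt t (ha.prodMk hb)
  have hv : ((a', b') : ℝ × ℝ) = a' • (1, 0) + b' • (0, 1) := by simp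
  rw [hv, map_add, map_smul, map_smul, smul_eq_mul, smul_eq_mul] at h
  exact h

/-- Mixed second partial derivatives of a `C²` function on the plane commute. -/
theorem fderiv_partial_comm {f : ℝ × ℝ → ℝ} (hf : ContDiff ℝ 2 f) (p v v' : ℝ × ℝ) :
    fderiv ℝ (fun q => fderiv ℝ f q v) p v' = fderiv ℝ (fun q => fderiv ℝ f q v') p v := by
  have hd : DifferentiableAt ℝ (fderiv ℝ f) p :=
    (hf.fderiv_right (m := 1) (by norm_num)).differentiable (by norm_num) p
  have hpartial (c d : ℝ × ℝ) :
      fderiv ℝ (fun q => fderiv ℝ f q c) p d = fderiv ℝ (fderiv ℝ f) p d c := by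
    rw [fderiv_clm_apply hd (differentiableAt_const c)]
    simp
  rw [hpartial, hpartial]
  exact hf.contDiffAt.isSymmSndFDerivAt (by simp) v' v

/-- Under the blow-up rescaling `z = x/(−y)`, `τ = −ln(−y)` (for `y < 0`),
setting `u(x,y) = w(x/(−y), −ln(−y))`, the function `u` is twice differentiable on the lower
half-plane and its Laplacian satisfies
`u_xx + u_yy = y⁻²·[w_ττ + w_τ + 2z w_zτ + (1+z²) w_zz + 2z w_z]`. -/
theorem laplacian_blow_up_rescaling (w : ℝ → ℝ → ℝ)
    (hw : ContDiff ℝ 2 (Function.uncurry w))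
    (u : ℝ → ℝ → ℝ) (hu : ∀ x y : ℝ, u x y = w (x / (-y)) (-Real.log (-y))) :
    ContDiffOn ℝ 2 (fun p : ℝ × ℝ => u p.1 p.2) {p : ℝ × ℝ | p.2 < 0} ∧
    ∀ x y : ℝ, y < 0 →
      deriv (deriv (fun x' => u x' y)) x + deriv (deriv (fun y' => u x y')) y
      = (y ^ 2)⁻¹ *
        (deriv (deriv (fun τ' => w (x / (-y)) τ')) (-Real.log (-y))
          + deriv (fun τ' => w (x / (-y)) τ') (-Real.log (-y))
          + 2 * (x / (-y))
            * deriv (fun τ' => deriv (fun z' => w z' τ') (x / (-y))) (-Real.log (-y))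
          + (1 + (x / (-y)) ^ 2)
            * deriv (deriv (fun z' => w z' (-Real.log (-y)))) (x / (-y))
          + 2 * (x / (-y)) * deriv (fun z' => w z' (-Real.log (-y))) (x / (-y))) := by
  obtain rfl : u = fun x y => w (x / (-y)) (-Real.log (-y)) := by
    ext x y
    exact hu x y
  refine ⟨?_, fun x y hy => ?_⟩
  · refine hw.comp_contDiffOn (ContDiffOn.prodMk ?_ ?_)
    · exact contDiffOn_fst.div contDiffOn_snd.neg fun p hp => neg_ne_zero.2 (ne_of_lt hp)
    · exact (contDiffOn_snd.neg.log fun p hp => neg_ne_zero.2 (ne_of_lt hp)).neg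
  set f : ℝ × ℝ → ℝ := Function.uncurry w with hf
  have hwf (a b : ℝ) : w a b = f (a, b) := rfl
  simp only [hwf]
  have hfd : Differentiable ℝ f := hw.differentiable (by norm_num)
  have hpartial (v : ℝ × ℝ) : Differentiable ℝ fun q => fderiv ℝ f q v :=
    ((hw.fderiv_right (m := 1) (by norm_num)).clm_apply contDiff_const).differentiable
      (by norm_num)
  have hz {F : ℝ × ℝ → ℝ} (hF : Differentiable ℝ F) (a b : ℝ) :
      deriv (fun s => F (s, b)) a = fderiv ℝ F (a, b) (1, 0) := by
    simpa using (hasDerivAt_comp_curve hF (hasDerivAt_id a) (hasDerivAt_const a b)).deriv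
  have hτ {F : ℝ × ℝ → ℝ} (hF : Differentiable ℝ F) (a b : ℝ) :
      deriv (fun s => F (a, s)) b = fderiv ℝ F (a, b) (0, 1) := by
    simpa using (hasDerivAt_comp_curve hF (hasDerivAt_const b a) (hasDerivAt_id b)).deriv
  have hx {F : ℝ × ℝ → ℝ} (hF : Differentiable ℝ F) (s : ℝ) :
      HasDerivAt (fun s => F (s / (-y), -Real.log (-y)))
        (1 / (-y) * fderiv ℝ F (s / (-y), -Real.log (-y)) (1, 0)) s := by
    simpa using hasDerivAt_comp_curve hF ((hasDerivAt_id s).div_const (-y))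
      (hasDerivAt_const s (-Real.log (-y)))
  have hy' {F : ℝ × ℝ → ℝ} (hF : Differentiable ℝ F) {t : ℝ} (ht : t < 0) :
      HasDerivAt (fun s => F (x / (-s), -Real.log (-s)))
        (x / t ^ 2 * fderiv ℝ F (x / (-t), -Real.log (-t)) (1, 0)
          + -t⁻¹ * fderiv ℝ F (x / (-t), -Real.log (-t)) (0, 1)) t := by
    have ht0 : -t ≠ 0 := neg_ne_zero.2 ht.ne
    refine hasDerivAt_comp_curve hF ?_ ?_
    · refine ((hasDerivAt_const t x).div (hasDerivAt_neg t) ht0).congr_deriv ?_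
      simp
    · refine ((hasDerivAt_neg t).log ht0).neg.congr_deriv ?_
      simp [neg_div_neg_eq]
  have hxx : deriv (deriv fun s => f (s / (-y), -Real.log (-y))) x = 1 / (-y) *
      (1 / (-y) * fderiv ℝ (fun q => fderiv ℝ f q (1, 0)) (x / (-y), -Real.log (-y)) (1, 0)) := by
    rw [funext fun s => (hx hfd s).deriv]
    exact ((hx (hpartial (1, 0)) x).const_mul _).deriv
  have hy1 : deriv (fun s => f (x / (-s), -Real.log (-s))) =ᶠ[nhds y] fun t =>
      x / t ^ 2 * fderiv ℝ f (x / (-t), -Real.log (-t)) (1, 0)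
        + -t⁻¹ * fderiv ℝ f (x / (-t), -Real.log (-t)) (0, 1) :=
    (eventually_lt_nhds hy).mono fun t ht => (hy' hfd ht).deriv
  have hyy := ((((hasDerivAt_const y x).div (hasDerivAt_pow 2 y) (pow_ne_zero 2 hy.ne)).mul
    (hy' (hpartial (1, 0)) hy)).add
    ((hasDerivAt_inv hy.ne).neg.mul (hy' (hpartial (0, 1)) hy))).deriv
  rw [hxx, hy1.deriv_eq]
  refine (congrArg _ hyy).trans ?_
  rw [funext fun s => hτ hfd (x / (-y)) s,
    funext fun s => hz hfd s (-Real.log (-y))]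
  simp only [hz hfd]
  rw [hτ (hpartial (0, 1)), hτ (hpartial (1, 0)), hz (hpartial (1, 0)),
    fderiv_partial_comm hw _ (0, 1) (1, 0)]
  have hy0 : y ≠ 0 := hy.ne
  simp only [Pi.div_apply, Pi.neg_apply]
  generalize fderiv ℝ (fun q => fderiv ℝ f q (1, 0)) (x / (-y), -Real.log (-y)) (1, 0) = Wzz
  generalize fderiv ℝ (fun q => fderiv ℝ f q (1, 0)) (x / (-y), -Real.log (-y)) (0, 1) = Wzt
  generalize fderiv ℝ (fun q => fderiv ℝ f q (0, 1)) (x / (-y), -Real.log (-y)) (0, 1) = Wtt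
  generalize fderiv ℝ f (x / (-y), -Real.log (-y)) (1, 0) = Wz
  generalize fderiv ℝ f (x / (-y), -Real.log (-y)) (0, 1) = Wt
  field_simp
  ring
end

section
/- Let l ≥ 1 be an integer and let p be a real polynomial of degree at most l that satisfies the pencil equation with parameter λ = −l, i.e. (1+z²)p''(z) + 2(1−l)z p'(z) + l(l−1)p(z) = 0 for all z ∈ ℝ. Then there exists a polynomial q in two real variables, harmonic on ℝ² (that is, ∂²q/∂x² + ∂²q/∂y² = 0 everywhere), such that q(x,y) = (−y)^l · p(x/(−y)) for all x ∈ ℝ and all y < 0. -/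
lemma deriv_deriv_sum_mul_const_mul_pow {ι : Type*} (t : Finset ι) (c : ι → ℝ) (m : ι → ℕ)
    (s x : ℝ) :
    deriv (deriv (fun u : ℝ => ∑ k ∈ t, c k * (s * u) ^ m k)) x
      = ∑ k ∈ t, c k * (s ^ 2 * (m k * (m k - 1 : ℕ)) * (s * x) ^ (m k - 1 - 1)) := by
  have hlin (u : ℝ) : HasDerivAt (fun u : ℝ => s * u) s u := by
    simpa using (hasDerivAt_id u).const_mul s
  have hfirst : deriv (fun u : ℝ => ∑ k ∈ t, c k * (s * u) ^ m k)
      = fun u => ∑ k ∈ t, c k * (m k * (s * u) ^ (m k - 1) * s) := by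
    funext u
    exact (HasDerivAt.fun_sum fun k _ => ((hlin u).fun_pow (m k)).const_mul (c k)).deriv
  rw [hfirst]
  refine ((HasDerivAt.fun_sum fun k _ => ((((hlin x).fun_pow (m k - 1)).const_mul
    (m k : ℝ)).mul_const s).const_mul (c k)).deriv).trans ?_
  exact Finset.sum_congr rfl fun k _ => by ring

/-- The coefficient recurrence equivalent to the pencil equation with parameter `-l`. -/
lemma pencil_coeff_recurrence (l : ℝ) (p : Polynomial ℝ)
    (hpencil : ∀ z : ℝ, (1 + z ^ 2) * (Polynomial.derivative (Polynomial.derivative p)).eval z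
        + 2 * (1 - l) * z * (Polynomial.derivative p).eval z
        + l * (l - 1) * p.eval z = 0) (k : ℕ) :
    ((k : ℝ) + 2) * (k + 1) * p.coeff (k + 2) + (l - k) * (l - k - 1) * p.coeff k = 0 := by
  have hpoly : Polynomial.derivative (Polynomial.derivative p)
      + Polynomial.derivative (Polynomial.derivative p) * Polynomial.X ^ 2
      + Polynomial.C (2 * (1 - l)) * (Polynomial.derivative p * Polynomial.X)
      + Polynomial.C (l * (l - 1)) * p = 0 := by
    refine Polynomial.funext fun z => ?_
    simp only [Polynomial.eval_add, Polynomial.eval_mul, Polynomial.eval_pow, Polynomial.eval_X,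
      Polynomial.eval_C, Polynomial.eval_zero]
    linear_combination hpencil z
  have hcoeff := congrArg (fun r => Polynomial.coeff r k) hpoly
  simp only [Polynomial.coeff_add, Polynomial.coeff_C_mul] at hcoeff
  rcases k with _ | _ | k <;>
    simp [Polynomial.coeff_derivative, Polynomial.coeff_mul_X_pow',
      Polynomial.coeff_mul_X] at hcoeff ⊢ <;>
    linear_combination hcoeff


/-- If a real polynomial `p` of degree at most `l` satisfies the pencil equation
with parameter `λ = −l`, then there is a harmonic polynomial `q` in two real variables with
`q(x,y) = (−y)^l · p(x/(−y))` for all `x` and all `y < 0`. -/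
theorem pencil_eigenfunction_from_harmonic_polynomial (l : ℕ) (hl : 1 ≤ l)
    (p : Polynomial ℝ) (hdeg : p.natDegree ≤ l)
    (hpencil : ∀ z : ℝ, (1 + z ^ 2) * (Polynomial.derivative (Polynomial.derivative p)).eval z
        + 2 * (1 - (l : ℝ)) * z * (Polynomial.derivative p).eval z
        + (l : ℝ) * ((l : ℝ) - 1) * p.eval z = 0) :
    ∃ q : MvPolynomial (Fin 2) ℝ,
      (∀ x y : ℝ,
        deriv (deriv (fun x' => MvPolynomial.eval ![x', y] q)) x
          + deriv (deriv (fun y' => MvPolynomial.eval ![x, y'] q)) y = 0) ∧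
      (∀ x y : ℝ, y < 0 →
        MvPolynomial.eval ![x, y] q = (-y) ^ l * p.eval (x / (-y))) := by
  obtain ⟨n, rfl⟩ : ∃ n, l = n + 1 := ⟨l - 1, by omega⟩
  let q : MvPolynomial (Fin 2) ℝ := ∑ k ∈ Finset.range (n + 2),
    MvPolynomial.C (p.coeff k) * MvPolynomial.X 0 ^ k * (-MvPolynomial.X 1) ^ (n + 1 - k)
  have hq (x y : ℝ) : MvPolynomial.eval ![x, y] q
      = ∑ k ∈ Finset.range (n + 2), p.coeff k * x ^ k * (-y) ^ (n + 1 - k) := by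
    simp [q]
  refine ⟨q, fun x y => ?_, fun x y hy => ?_⟩
  · have hx : (fun x' => MvPolynomial.eval ![x', y] q) = fun x' => ∑ k ∈ Finset.range (n + 2),
        p.coeff k * (-y) ^ (n + 1 - k) * (1 * x') ^ k := by
      funext x'
      rw [hq]
      exact Finset.sum_congr rfl fun k _ => by ring
    have hy : (fun y' => MvPolynomial.eval ![x, y'] q) = fun y' => ∑ k ∈ Finset.range (n + 2),
        p.coeff k * x ^ k * (-1 * y') ^ (n + 1 - k) := by
      funext y'
      rw [hq]
      exact Finset.sum_congr rfl fun k _ => by ring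
    rw [hx, hy, deriv_deriv_sum_mul_const_mul_pow, deriv_deriv_sum_mul_const_mul_pow,
      Finset.sum_range_succ', Finset.sum_range_succ',
      Finset.sum_range_succ (n := n + 1), Finset.sum_range_succ (n := n)]
    simp only [Nat.add_sub_cancel_left, Nat.sub_self, Nat.cast_zero, Nat.cast_one, zero_mul,
      mul_zero, add_zero, zero_add]
    rw [← Finset.sum_add_distrib]
    refine Finset.sum_eq_zero fun k hk => ?_
    obtain ⟨d, rfl⟩ : ∃ d, n = k + 1 + d := Nat.exists_eq_add_of_lt (Finset.mem_range.mp hk) |>.imp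
      fun d hd => by omega
    have hrec := pencil_coeff_recurrence _ p hpencil k
    rw [show k + 1 + d + 1 - (k + 1 + 1) = d by omega, show k + 1 + d + 1 - k = d + 2 by omega,
      show k + 1 + 1 - 1 = k + 1 by omega, show d + 2 - 1 = d + 1 by omega]
    simp only [Nat.add_sub_cancel]
    push_cast at hrec ⊢
    linear_combination (-y) ^ d * x ^ k * hrec
  · rw [hq, Polynomial.eval_eq_sum_range' (Nat.lt_succ_of_le hdeg), Finset.mul_sum]
    refine Finset.sum_congr rfl fun k hk => ?_
    have hy' : -y ≠ 0 := by linarith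
    rw [← Nat.sub_add_cancel (Nat.lt_succ_iff.mp (Finset.mem_range.mp hk)), pow_add,
      Nat.sub_add_cancel (Nat.lt_succ_iff.mp (Finset.mem_range.mp hk)), div_pow]
    field_simp
end

section
/- Let n ≥ 0 and define g : ℝ → ℝ by g(z) = (1+z²)^{−1}·exp(−n/((1+n)(1+z²))). Then g is differentiable, strictly positive, and satisfies the first-order linear ODE (1+n)(1+z²)² g'(z) + 2z[1 + (1+n)z²] g(z) = 0 for all z ∈ ℝ. Consequently, any twice-differentiable Ψ : ℝ → ℝ with Ψ' = g satisfies (1+n)(1+z²)² Ψ''(z) + 2z[1 + (1+n)z²] Ψ'(z) = 0 for all z ∈ ℝ, which is the nonlinear pencil equation specialized to Λ = 0. -/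
/-- The derivative of `(1+z²)⁻¹·exp(−n/((1+n)(1+z²)))`, written through its logarithmic
derivative. -/
theorem hasDerivAt_inv_one_add_sq_mul_exp {n : ℝ} (hn : 1 + n ≠ 0) (z : ℝ) :
    HasDerivAt (fun z : ℝ => (1 + z ^ 2)⁻¹ * Real.exp (-n / ((1 + n) * (1 + z ^ 2))))
      (-(2 * z * (1 + (1 + n) * z ^ 2)) / ((1 + n) * (1 + z ^ 2) ^ 2)
        * ((1 + z ^ 2)⁻¹ * Real.exp (-n / ((1 + n) * (1 + z ^ 2))))) z := by
  have hz : 1 + z ^ 2 ≠ 0 := by positivity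
  have hq : HasDerivAt (fun z : ℝ => 1 + z ^ 2) (2 * z) z := by
    simpa using (hasDerivAt_pow 2 z).const_add 1
  have he := ((hasDerivAt_const z (-n)).fun_div (hq.const_mul (1 + n))
    (mul_ne_zero hn hz)).exp
  refine ((hq.fun_inv hz).fun_mul he).congr_deriv ?_
  field_simp
  ring

/-- For `n ≥ 0`, the function `g(z) = (1+z²)⁻¹·exp(−n/((1+n)(1+z²)))` is
differentiable, strictly positive, and satisfies
`(1+n)(1+z²)² g'(z) + 2z[1+(1+n)z²] g(z) = 0`. Consequently any twice-differentiable `Ψ`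
with `Ψ' = g` satisfies `(1+n)(1+z²)² Ψ'' + 2z[1+(1+n)z²] Ψ' = 0` (the nonlinear pencil
equation specialized to `Λ = 0`). -/
theorem nonlinear_pencil_lambda_zero_solution (n : ℝ) (hn : 0 ≤ n)
    (g : ℝ → ℝ)
    (hg : ∀ z : ℝ, g z = (1 + z ^ 2)⁻¹ * Real.exp (-n / ((1 + n) * (1 + z ^ 2)))) :
    Differentiable ℝ g ∧
    (∀ z : ℝ, 0 < g z) ∧
    (∀ z : ℝ, (1 + n) * (1 + z ^ 2) ^ 2 * deriv g z
        + 2 * z * (1 + (1 + n) * z ^ 2) * g z = 0) ∧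
    (∀ Ψ : ℝ → ℝ, Differentiable ℝ Ψ → deriv Ψ = g →
      ∀ z : ℝ, (1 + n) * (1 + z ^ 2) ^ 2 * deriv (deriv Ψ) z
        + 2 * z * (1 + (1 + n) * z ^ 2) * deriv Ψ z = 0) := by
  have hn1 : 1 + n ≠ 0 := by positivity
  have hd : ∀ z, HasDerivAt g
      (-(2 * z * (1 + (1 + n) * z ^ 2)) / ((1 + n) * (1 + z ^ 2) ^ 2) * g z) z := by
    intro z
    rw [funext hg]
    exact hasDerivAt_inv_one_add_sq_mul_exp hn1 z
  have hode : ∀ z : ℝ, (1 + n) * (1 + z ^ 2) ^ 2 * deriv g z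
      + 2 * z * (1 + (1 + n) * z ^ 2) * g z = 0 := by
    intro z
    have hz : 1 + z ^ 2 ≠ 0 := by positivity
    rw [(hd z).deriv]
    field_simp
    ring
  refine ⟨fun z => (hd z).differentiableAt, fun z => ?_, hode, ?_⟩
  · rw [hg z]
    positivity
  · rintro Ψ - rfl
    exact hode
end

section
/- There exists n₀ > 0 such that for every n ≥ n₀ the characteristic quartic with l = 2 has no real roots: Φ_2(Λ; n) = (1+n)Λ⁴ + 9(1+n)Λ³ + 34(1+n)Λ² + (60n+64)Λ + 48(1+n) > 0 for all Λ ∈ ℝ. Hence for all sufficiently large n there are no real nonlinear eigenvalues Λ_2(n), so the two eigenvalue branches emanating at n = 0 from Λ = −2 and Λ = −3 cannot be continued to all n > 0. -/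
/-- There exists `n₀ > 0` such that for every `n ≥ n₀` the characteristic
quartic with `l = 2`, `Φ₂(Λ; n) = (1+n)Λ⁴ + 9(1+n)Λ³ + 34(1+n)Λ² + (60n+64)Λ + 48(1+n)`,
is strictly positive for all real `Λ`; hence for all sufficiently large `n` there are no
real nonlinear eigenvalues `Λ₂(n)`. -/
theorem characteristic_quartic_l_two_no_real_roots_large_n :
    ∃ n₀ : ℝ, 0 < n₀ ∧ ∀ n : ℝ, n₀ ≤ n → ∀ Λ : ℝ,
      0 < (1 + n) * Λ ^ 4 + 9 * (1 + n) * Λ ^ 3 + 34 * (1 + n) * Λ ^ 2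
        + (60 * n + 64) * Λ + 48 * (1 + n) := by
  refine ⟨3, by norm_num, fun n hn Λ => ?_⟩
  have hq : Λ ^ 4 + 9 * Λ ^ 3 + 34 * Λ ^ 2 + 60 * Λ + 48
      = (Λ + 2) ^ 2 * ((Λ + 5 / 2) ^ 2 + 15 / 4) + 8 := by ring
  have hpos : 0 < Λ ^ 4 + 9 * Λ ^ 3 + 34 * Λ ^ 2 + 60 * Λ + 48 := by
    rw [hq]; positivity
  have hpos' : 0 < Λ ^ 4 + 9 * Λ ^ 3 + 34 * Λ ^ 2 + 60 * Λ + 48 + Λ := by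
    rw [hq]
    nlinarith [sq_nonneg ((Λ + 2) * (Λ + 5 / 2)), sq_nonneg (Λ + 2 + 1 / 2)]
  nlinarith [mul_nonneg (sub_nonneg.mpr hn) hpos.le]
end
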